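/- arXiv:1407.7974 — 2 statements merged into one kernel-verified Lean document; each statement's English description precedes it below -/
import Mathlib

section
/- Let b₋, b₊ > 0 and δ ∈ ℝ. Then for all real u₁, u₂ with H(u₁ + i b₋, u₂) ≠ 0, the value P(u₁ + i b₋, u₂) is a nonnegative real number, and for all real u₁, u₂ with H(u₁, u₂ + i b₊) ≠ 0, the value P(u₁, u₂ + i b₊) is a nonnegative real number. (Hence the amplitude formula of the two-phase solution remains real and nonnegative when the initial phase is shifted by the purely imaginary half-periods i b₋ or i b₊; a real smooth finite-gap solution of the NLS equation may have a complex initial phase.) -/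
open Complex

/-- Jacobi elliptic theta function `θ₃(u|τ)`. -/
noncomputable def theta3 (u τ : ℂ) : ℂ :=
  ∑' m : ℤ, Complex.exp (Real.pi * I * (m : ℂ) ^ 2 * τ + 2 * Real.pi * I * (m : ℂ) * u)

/-- Jacobi elliptic theta function `θ₂(u|τ)`. -/
noncomputable def theta2 (u τ : ℂ) : ℂ :=
  ∑' m : ℤ, Complex.exp (Real.pi * I * ((m : ℂ) + 1 / 2) ^ 2 * τ
    + 2 * Real.pi * I * ((m : ℂ) + 1 / 2) * u)

/-- The combination of products of Jacobi theta functions appearing in the two-phase solution. -/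
noncomputable def H (bm bp : ℝ) (u₁ u₂ : ℂ) : ℂ :=
  theta3 u₁ (2 * I * bm) * theta3 u₂ (2 * I * bp)
    + theta2 u₁ (2 * I * bm) * theta3 u₂ (2 * I * bp)
    + theta3 u₁ (2 * I * bm) * theta2 u₂ (2 * I * bp)
    - theta2 u₁ (2 * I * bm) * theta2 u₂ (2 * I * bp)

/-- The squared amplitude ratio of the two-phase solution. -/
noncomputable def P (bm bp δ : ℝ) (u₁ u₂ : ℂ) : ℂ :=
  H bm bp (u₁ - I * δ) (u₂ - 1) * H bm bp (u₁ + I * δ) (u₂ + 1) / (H bm bp u₁ u₂) ^ 2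

open ComplexConjugate in
lemma theta3_conj (u : ℂ) (b : ℝ) : conj (theta3 u (2 * I * b)) = theta3 (conj u) (2 * I * b) := by
  rw [theta3, theta3, Complex.conj_tsum, ← (Equiv.neg ℤ).tsum_eq]
  refine tsum_congr fun m ↦ ?_
  rw [← Complex.exp_conj]
  congr 1
  simp only [map_add, map_neg, map_mul, map_pow, conj_I, conj_ofReal, map_ofNat, map_intCast,
    Equiv.neg_apply, Int.cast_neg]
  ring

open ComplexConjugate in
lemma theta2_conj (u : ℂ) (b : ℝ) : conj (theta2 u (2 * I * b)) = theta2 (conj u) (2 * I * b) := by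
  rw [theta2, theta2, Complex.conj_tsum, ← (Equiv.subLeft (-1 : ℤ)).tsum_eq]
  refine tsum_congr fun m ↦ ?_
  rw [← Complex.exp_conj]
  congr 1
  simp only [map_add, map_sub, map_neg, map_mul, map_pow, map_div₀, map_one, conj_I, conj_ofReal, map_ofNat,
    map_intCast, Equiv.subLeft_apply, Int.cast_sub, Int.cast_neg, Int.cast_one]
  ring

lemma theta3_add_one (u τ : ℂ) : theta3 (u + 1) τ = theta3 u τ := by
  refine tsum_congr fun m ↦ ?_
  rw [← Complex.exp_periodic.int_mul m (_ + 2 * Real.pi * I * (m : ℂ) * u)]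
  congr 1
  ring

lemma theta2_add_one (u τ : ℂ) : theta2 (u + 1) τ = -theta2 u τ := by
  rw [theta2, theta2, ← tsum_neg]
  refine tsum_congr fun m ↦ ?_
  rw [← Complex.exp_antiperiodic, ← Complex.exp_periodic.int_mul m (_ + Real.pi * I)]
  congr 1
  ring

lemma theta3_add_half_period (u : ℂ) (b : ℝ) :
    theta3 (u + I * b) (2 * I * b) =
      exp (Real.pi * b / 2 - Real.pi * I * u) * theta2 u (2 * I * b) := by
  rw [theta3, theta2, ← tsum_mul_left]
  refine tsum_congr fun m ↦ ?_
  rw [← Complex.exp_add]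
  congr 1
  linear_combination (-(Real.pi : ℂ) * b / 2) * I_sq

lemma theta2_add_half_period (u : ℂ) (b : ℝ) :
    theta2 (u + I * b) (2 * I * b) =
      exp (Real.pi * b / 2 - Real.pi * I * u) * theta3 u (2 * I * b) := by
  rw [theta3, theta2, ← tsum_mul_left, ← (Equiv.addRight (1 : ℤ)).tsum_eq (fun m : ℤ ↦ exp _ * _)]
  refine tsum_congr fun m ↦ ?_
  rw [← Complex.exp_add, Equiv.coe_addRight, Int.cast_add, Int.cast_one]
  congr 1
  linear_combination (-(Real.pi : ℂ) * b / 2) * I_sq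

open ComplexConjugate in
lemma H_conj (bm bp : ℝ) (u₁ u₂ : ℂ) : conj (H bm bp u₁ u₂) = H bm bp (conj u₁) (conj u₂) := by
  simp only [H, map_add, map_sub, map_mul, theta2_conj, theta3_conj]

lemma H_add_half_period_left (bm bp : ℝ) (u₁ u₂ : ℂ) :
    H bm bp (u₁ + I * bm) u₂ =
      exp (Real.pi * bm / 2 - Real.pi * I * u₁) * H bm bp u₁ (u₂ + 1) := by
  simp only [H, theta2_add_half_period, theta3_add_half_period, theta2_add_one, theta3_add_one]
  ring

lemma H_add_half_period_right (bm bp : ℝ) (u₁ u₂ : ℂ) :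
    H bm bp u₁ (u₂ + I * bp) =
      exp (Real.pi * bp / 2 - Real.pi * I * u₂) * H bm bp (u₁ + 1) u₂ := by
  simp only [H, theta2_add_half_period, theta3_add_half_period, theta2_add_one, theta3_add_one]
  ring

lemma H_add_one_add_one_right (bm bp : ℝ) (u₁ u₂ : ℂ) :
    H bm bp u₁ (u₂ + 1 + 1) = H bm bp u₁ u₂ := by
  simp only [H, theta2_add_one, theta3_add_one, neg_neg]

lemma P_add_half_period_left (bm bp δ : ℝ) (u₁ u₂ : ℂ) :
    P bm bp δ (u₁ + I * bm) u₂ =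
      H bm bp (u₁ - I * δ) u₂ * H bm bp (u₁ + I * δ) u₂ / H bm bp u₁ (u₂ + 1) ^ 2 := by
  rw [P, add_sub_right_comm, add_right_comm, H_add_half_period_left, H_add_half_period_left,
    H_add_half_period_left, H_add_one_add_one_right, sub_add_cancel, mul_mul_mul_comm, mul_pow,
    ← Complex.exp_add, ← Complex.exp_nat_mul,
    ← mul_div_mul_left _ (_ ^ 2) (Complex.exp_ne_zero _)]
  congr 3
  push_cast
  ring

lemma P_add_half_period_right (bm bp δ : ℝ) (u₁ u₂ : ℂ) :
    P bm bp δ u₁ (u₂ + I * bp) =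
      H bm bp (u₁ + 1 - I * δ) (u₂ + 1) * H bm bp (u₁ + 1 + I * δ) (u₂ + 1) /
        H bm bp (u₁ + 1) u₂ ^ 2 := by
  rw [P, add_sub_right_comm, add_right_comm u₂, H_add_half_period_right, H_add_half_period_right,
    H_add_half_period_right, ← H_add_one_add_one_right _ _ _ (u₂ - 1), sub_add_cancel,
    mul_mul_mul_comm, mul_pow, ← Complex.exp_add, ← Complex.exp_nat_mul, sub_add_eq_add_sub u₁,
    add_right_comm u₁ _ 1,
    ← mul_div_mul_left _ (_ ^ 2) (Complex.exp_ne_zero _)]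
  congr 3
  push_cast
  ring

lemma exists_nonneg_eq_H_ratio (bm bp δ x y x' y' : ℝ) :
    ∃ r : ℝ, 0 ≤ r ∧
      H bm bp (x - I * δ) y * H bm bp (x + I * δ) y / H bm bp x' y' ^ 2 = r := by
  have hnum : H bm bp (x - I * δ) y = (starRingEnd ℂ) (H bm bp (x + I * δ) y) := by
    simp [H_conj, sub_eq_add_neg]
  obtain ⟨d, hd⟩ : ∃ d : ℝ, H bm bp x' y' = d :=
    Complex.conj_eq_iff_real.mp (by simp [H_conj])
  refine ⟨normSq (H bm bp (x + I * δ) y) / d ^ 2,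
    div_nonneg (normSq_nonneg _) (sq_nonneg d), ?_⟩
  rw [hnum, hd, mul_comm, mul_conj]
  push_cast
  rfl

/-- The amplitude formula of the two-phase solution remains real and nonnegative when the
initial phase is shifted by the purely imaginary half-periods `i b₋` or `i b₊`: a real smooth
finite-gap solution of the NLS equation may have a complex initial phase. -/
theorem P_real_nonneg_at_imaginary_half_periods (bm bp δ : ℝ) (hbm : 0 < bm) (hbp : 0 < bp)
    (u₁ u₂ : ℝ) :
    (H bm bp ((u₁ : ℂ) + I * bm) (u₂ : ℂ) ≠ 0 →
      ∃ r : ℝ, 0 ≤ r ∧ P bm bp δ ((u₁ : ℂ) + I * bm) (u₂ : ℂ) = r) ∧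
    (H bm bp (u₁ : ℂ) ((u₂ : ℂ) + I * bp) ≠ 0 →
      ∃ r : ℝ, 0 ≤ r ∧ P bm bp δ (u₁ : ℂ) ((u₂ : ℂ) + I * bp) = r) := by
  refine ⟨fun _ ↦ ?_, fun _ ↦ ?_⟩
  · rw [P_add_half_period_left]
    exact_mod_cast exists_nonneg_eq_H_ratio bm bp δ u₁ u₂ u₁ (u₂ + 1)
  · rw [P_add_half_period_right]
    exact_mod_cast exists_nonneg_eq_H_ratio bm bp δ (u₁ + 1) (u₂ + 1) (u₁ + 1) u₂
end

section
/- Let 0 < b < c be fixed. Then the function a ↦ ∫_{a²}^{b²} dt/√(t·(t − a²)·(b² − t)·(c² − t)), defined for 0 < a < b, tends to π/(b·√(c² − b²)) as a → b⁻. -/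
open MeasureTheory Set Filter

/-- The antiderivative of `1 / √((t - p) (q - t))` on `(p, q)`. -/
theorem hasDerivAt_arcsin_affine {p q t : ℝ} (ht : t ∈ Ioo p q) :
    HasDerivAt (fun t => Real.arcsin ((2 * t - p - q) / (q - p)))
      (1 / Real.sqrt ((t - p) * (q - t))) t := by
  obtain ⟨hp, hq⟩ := ht
  have hpq : 0 < q - p := by linarith
  have hlo : (2 * t - p - q) / (q - p) ≠ -1 := by
    rw [ne_eq, div_eq_iff hpq.ne']
    intro h
    linarith
  have hhi : (2 * t - p - q) / (q - p) ≠ 1 := by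
    rw [ne_eq, div_eq_iff hpq.ne']
    intro h
    linarith
  have haff : HasDerivAt (fun t : ℝ => (2 * t - p - q) / (q - p)) (2 / (q - p)) t := by
    simpa using ((((hasDerivAt_id t).const_mul 2).sub_const p).sub_const q).div_const (q - p)
  refine ((Real.hasDerivAt_arcsin hlo hhi).comp t haff).congr_deriv ?_
  have hsq : 1 - ((2 * t - p - q) / (q - p)) ^ 2 =
      (2 / (q - p)) ^ 2 * ((t - p) * (q - t)) := by
    field_simp
    ring
  have hpos : 0 < (t - p) * (q - t) := mul_pos (by linarith) (by linarith)
  rw [hsq, Real.sqrt_mul (sq_nonneg _), Real.sqrt_sq (by positivity)]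
  have := Real.sqrt_pos.2 hpos
  field_simp

theorem continuous_arcsin_affine (p q : ℝ) :
    Continuous fun t => Real.arcsin ((2 * t - p - q) / (q - p)) :=
  Real.continuous_arcsin.comp (by fun_prop)

theorem integrableOn_one_div_sqrt_mul (p q : ℝ) :
    IntegrableOn (fun t => 1 / Real.sqrt ((t - p) * (q - t))) (Ioo p q) :=
  (intervalIntegral.integrableOn_deriv_of_nonneg (continuous_arcsin_affine p q).continuousOn
    (fun _ ht => hasDerivAt_arcsin_affine ht) (fun _ _ => by positivity)).mono_set Ioo_subset_Ioc_self

theorem integral_one_div_sqrt_mul {p q : ℝ} (hpq : p < q) :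
    ∫ t in Ioo p q, 1 / Real.sqrt ((t - p) * (q - t)) = Real.pi := by
  have hne : q - p ≠ 0 := by linarith
  rw [← integral_Ioc_eq_integral_Ioo, ← intervalIntegral.integral_of_le hpq.le,
    intervalIntegral.integral_eq_sub_of_hasDerivAt_of_le hpq.le
      (continuous_arcsin_affine p q).continuousOn (fun _ ht => hasDerivAt_arcsin_affine ht)
      ((intervalIntegrable_iff_integrableOn_Ioo_of_le hpq.le).2
        (integrableOn_one_div_sqrt_mul p q))]
  have hq : (2 * q - p - q) / (q - p) = 1 := by
    rw [div_eq_one_iff_eq hne]; ring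
  have hp : (2 * p - p - q) / (q - p) = -1 := by
    rw [div_eq_iff hne]; ring
  rw [hq, hp, Real.arcsin_neg, Real.arcsin_one]
  ring

/-- A positive weight `w` between `m > 0` and `M` on `(p, q)` gives two-sided bounds. -/
theorem integral_one_div_sqrt_mul_weight_mem_Icc {p q m M : ℝ} {w : ℝ → ℝ} (hpq : p < q)
    (hm : 0 < m) (hw : Measurable w) (hmw : ∀ t ∈ Ioo p q, m ≤ w t)
    (hwM : ∀ t ∈ Ioo p q, w t ≤ M) :
    ∫ t in Ioo p q, 1 / Real.sqrt (w t * ((t - p) * (q - t))) ∈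
      Icc (1 / Real.sqrt M * Real.pi) (1 / Real.sqrt m * Real.pi) := by
  have hint := integrableOn_one_div_sqrt_mul p q
  have hsplit : ∀ t ∈ Ioo p q, 1 / Real.sqrt (w t * ((t - p) * (q - t))) =
      1 / Real.sqrt (w t) * (1 / Real.sqrt ((t - p) * (q - t))) := by
    intro t ht
    rw [Real.sqrt_mul (hm.le.trans (hmw t ht)), one_div_mul_one_div]
  have hlower : ∀ t ∈ Ioo p q, 1 / Real.sqrt M * (1 / Real.sqrt ((t - p) * (q - t))) ≤
      1 / Real.sqrt (w t * ((t - p) * (q - t))) := by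
    intro t ht
    rw [hsplit t ht]
    have := Real.sqrt_pos.2 (hm.trans_le (hmw t ht))
    have := Real.sqrt_le_sqrt (hwM t ht)
    gcongr
  have hupper : ∀ t ∈ Ioo p q, 1 / Real.sqrt (w t * ((t - p) * (q - t))) ≤
      1 / Real.sqrt m * (1 / Real.sqrt ((t - p) * (q - t))) := by
    intro t ht
    rw [hsplit t ht]
    have := Real.sqrt_pos.2 hm
    have := Real.sqrt_le_sqrt (hmw t ht)
    gcongr
  have hmid : IntegrableOn (fun t => 1 / Real.sqrt (w t * ((t - p) * (q - t)))) (Ioo p q) := by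
    refine Integrable.mono' (hint.const_mul (1 / Real.sqrt m)) ?_ ?_
    · exact Measurable.aestronglyMeasurable (by fun_prop)
    · refine (ae_restrict_iff' measurableSet_Ioo).2 (Eventually.of_forall fun t ht => ?_)
      rw [Real.norm_of_nonneg (by positivity)]
      exact hupper t ht
  rw [← integral_one_div_sqrt_mul hpq, ← integral_const_mul, ← integral_const_mul]
  exact ⟨setIntegral_mono_on (hint.const_mul _) hmid measurableSet_Ioo hlower,
    setIntegral_mono_on hmid (hint.const_mul _) measurableSet_Ioo hupper⟩

/-- As `a → b⁻`, the elliptic integral `∫_{a²}^{b²} dt/√(t(t − a²)(b² − t)(c² − t))` tends to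
`π/(b√(c² − b²))`. -/
theorem elliptic_integral_limit_a_to_b' (b c : ℝ) (hb : 0 < b) (hbc : b < c) :
    Tendsto (fun a : ℝ =>
        ∫ t in Ioo (a ^ 2) (b ^ 2),
          1 / Real.sqrt (t * (t - a ^ 2) * (b ^ 2 - t) * (c ^ 2 - t)))
      (nhdsWithin b (Iio b)) (nhds (Real.pi / (b * Real.sqrt (c ^ 2 - b ^ 2)))) := by
  have hcb : 0 < c ^ 2 - b ^ 2 := by nlinarith
  have hlim : Real.pi / (b * Real.sqrt (c ^ 2 - b ^ 2)) =
      1 / Real.sqrt (b ^ 2 * (c ^ 2 - b ^ 2)) * Real.pi := by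
    rw [Real.sqrt_mul (sq_nonneg b), Real.sqrt_sq hb.le]
    ring
  have hne : Real.sqrt (b ^ 2 * (c ^ 2 - b ^ 2)) ≠ 0 := by positivity
  have hlow : Tendsto (fun a : ℝ => 1 / Real.sqrt (b ^ 2 * (c ^ 2 - a ^ 2)) * Real.pi)
      (nhdsWithin b (Iio b)) (nhds (1 / Real.sqrt (b ^ 2 * (c ^ 2 - b ^ 2)) * Real.pi)) := by
    have : ContinuousAt (fun a : ℝ => 1 / Real.sqrt (b ^ 2 * (c ^ 2 - a ^ 2)) * Real.pi) b := by
      fun_prop (disch := exact hne)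
    exact this.tendsto.mono_left nhdsWithin_le_nhds
  have hupp : Tendsto (fun a : ℝ => 1 / Real.sqrt (a ^ 2 * (c ^ 2 - b ^ 2)) * Real.pi)
      (nhdsWithin b (Iio b)) (nhds (1 / Real.sqrt (b ^ 2 * (c ^ 2 - b ^ 2)) * Real.pi)) := by
    have : ContinuousAt (fun a : ℝ => 1 / Real.sqrt (a ^ 2 * (c ^ 2 - b ^ 2)) * Real.pi) b := by
      fun_prop (disch := exact hne)
    exact this.tendsto.mono_left nhdsWithin_le_nhds
  have hbounds : ∀ᶠ a in nhdsWithin b (Iio b),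
      ∫ t in Ioo (a ^ 2) (b ^ 2),
          1 / Real.sqrt (t * (t - a ^ 2) * (b ^ 2 - t) * (c ^ 2 - t)) ∈
        Icc (1 / Real.sqrt (b ^ 2 * (c ^ 2 - a ^ 2)) * Real.pi)
          (1 / Real.sqrt (a ^ 2 * (c ^ 2 - b ^ 2)) * Real.pi) := by
    filter_upwards [Ioo_mem_nhdsLT hb] with a ha
    obtain ⟨ha, hab⟩ := ha
    have hpq : a ^ 2 < b ^ 2 := by gcongr
    have hrw : ∀ t : ℝ, t * (t - a ^ 2) * (b ^ 2 - t) * (c ^ 2 - t) =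
        t * (c ^ 2 - t) * ((t - a ^ 2) * (b ^ 2 - t)) := fun t => by ring
    simp only [hrw]
    refine integral_one_div_sqrt_mul_weight_mem_Icc hpq (by positivity) (by fun_prop) ?_ ?_
    · rintro t ⟨h₁, h₂⟩
      have : 0 < t := (by positivity : 0 < a ^ 2).trans h₁
      exact mul_le_mul h₁.le (by linarith) hcb.le this.le
    · rintro t ⟨h₁, h₂⟩
      exact mul_le_mul h₂.le (by linarith) (by linarith) (by positivity)
  rw [hlim]
  exact tendsto_of_tendsto_of_tendsto_of_le_of_le' hlow hupp
    (hbounds.mono fun _ h => h.1) (hbounds.mono fun _ h => h.2)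
end
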